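/- For each positive integer r let p_r(x) = x^r. For every positive integer A, the limit L(A) = lim_{i→∞} Γ(p_{2i}, p_{2Ai}) (limit over positive integers i, i.e. along even exponents 2i and 2Ai) exists, and L(A) → 0 as A → ∞ (A ranging over positive integers). -/

import Mathlib

open MeasureTheory ProbabilityTheory Filter Topology

noncomputable section

/-- The bilinear form `Γ(f,g)` from the paper.  (The integrand is interpreted as `0` on the
measure-zero diagonal `x = y`, since in Lean division by zero yields zero.) -/
def Gam (f g : ℝ → ℝ) : ℝ :=
  (1 / Real.pi ^ 2) *
    ∫ x in (-1 : ℝ)..1, ∫ y in (-1 : ℝ)..1,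
      ((f x - f y) / (x - y)) * ((g x - g y) / (x - y)) *
        ((1 - x * y) / (Real.sqrt (1 - x ^ 2) * Real.sqrt (1 - y ^ 2)))

/-- The difference quotient `(x ^ n - y ^ n) / (x - y)`, as a polynomial. -/
def powDiffQuot (n : ℕ) (x y : ℝ) : ℝ :=
  ∑ i ∈ Finset.range n, x ^ i * y ^ (n - 1 - i)

theorem powDiffQuot_mul (n : ℕ) (x y : ℝ) : powDiffQuot n x y * (x - y) = x ^ n - y ^ n :=
  (Commute.all x y).geom_sum₂_mul n

theorem powDiffQuot_succ (n : ℕ) (x y : ℝ) :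
    powDiffQuot (n + 1) x y = x ^ n + y * powDiffQuot n x y :=
  (Commute.all x y).geom_sum₂_succ_eq

theorem powDiffQuot_succ' (n : ℕ) (x y : ℝ) :
    powDiffQuot (n + 1) x y = y ^ n + x * powDiffQuot n x y := by
  linear_combination powDiffQuot_succ n x y - powDiffQuot_mul n x y

theorem powDiffQuot_second_difference (n m : ℕ) (x y : ℝ) :
    powDiffQuot (n + 2) x y * powDiffQuot m x y + powDiffQuot n x y * powDiffQuot (m + 2) x y
      = 2 * (powDiffQuot (n + 1) x y * powDiffQuot (m + 1) x y)
        - x ^ n * y ^ m - x ^ m * y ^ n := by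
  rw [powDiffQuot_succ' (n + 1), powDiffQuot_succ (m + 1), powDiffQuot_succ' n,
    powDiffQuot_succ m]
  linear_combination (powDiffQuot m x y * (x - y) - x ^ m) * powDiffQuot_mul n x y +
    x ^ n * powDiffQuot_mul m x y

@[fun_prop]
theorem continuous_powDiffQuot (n : ℕ) {X : Type*} [TopologicalSpace X] {f g : X → ℝ}
    (hf : Continuous f) (hg : Continuous g) : Continuous fun z => powDiffQuot n (f z) (g z) := by
  unfold powDiffQuot
  fun_prop

/-- The integral of `q` against the square of the arcsine measure, in angular coordinates. -/
def arcsineIntegral (q : ℝ → ℝ → ℝ) : ℝ :=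
  ∫ s in (0 : ℝ)..Real.pi, ∫ t in (0 : ℝ)..Real.pi, q (Real.cos s) (Real.cos t)

theorem arcsineIntegral_add {p q : ℝ → ℝ → ℝ} (hp : Continuous p.uncurry)
    (hq : Continuous q.uncurry) :
    arcsineIntegral (fun x y => p x y + q x y) = arcsineIntegral p + arcsineIntegral q := by
  have inner {r : ℝ → ℝ → ℝ} (hr : Continuous r.uncurry) (s : ℝ) :
      Continuous fun t => r (Real.cos s) (Real.cos t) :=
    hr.comp (by fun_prop : Continuous fun t => (Real.cos s, Real.cos t))
  have outer {r : ℝ → ℝ → ℝ} (hr : Continuous r.uncurry) :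
      Continuous fun s => ∫ t in (0 : ℝ)..Real.pi, r (Real.cos s) (Real.cos t) :=
    intervalIntegral.continuous_parametric_intervalIntegral_of_continuous'
      (f := fun s t => r (Real.cos s) (Real.cos t))
      (hr.comp (by fun_prop : Continuous fun z : ℝ × ℝ => (Real.cos z.1, Real.cos z.2))) _ _
  unfold arcsineIntegral
  rw [← intervalIntegral.integral_add ((outer hp).intervalIntegrable _ _)
    ((outer hq).intervalIntegrable _ _)]
  congr! 2 with s
  exact intervalIntegral.integral_add ((inner hp s).intervalIntegrable _ _)
    ((inner hq s).intervalIntegrable _ _)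

theorem arcsineIntegral_const_mul (c : ℝ) (q : ℝ → ℝ → ℝ) :
    arcsineIntegral (fun x y => c * q x y) = c * arcsineIntegral q := by
  simp [arcsineIntegral]

/-- The unnormalised moments of the arcsine distribution. -/
def arcsineMoment (n : ℕ) : ℝ := ∫ t in (0 : ℝ)..Real.pi, Real.cos t ^ n

theorem arcsineMoment_zero : arcsineMoment 0 = Real.pi := by simp [arcsineMoment]

theorem arcsineMoment_one : arcsineMoment 1 = 0 := by simp [arcsineMoment]

theorem arcsineMoment_add_two (n : ℕ) :
    (n + 2) * arcsineMoment (n + 2) = (n + 1) * arcsineMoment n := by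
  have h := integral_cos_pow (a := 0) (b := Real.pi) n
  simp only [Real.sin_pi, Real.sin_zero, mul_zero, sub_zero, zero_div, zero_add] at h
  simp only [arcsineMoment, h]
  field_simp

theorem arcsineMoment_odd (n : ℕ) : arcsineMoment (2 * n + 1) = 0 := by
  induction n with
  | zero => exact arcsineMoment_one
  | succ n ih =>
    have h := arcsineMoment_add_two (2 * n + 1)
    rw [ih, mul_zero] at h
    exact (mul_eq_zero.mp h).resolve_left (by positivity)

theorem arcsineIntegral_pow_mul_pow (n m : ℕ) :
    arcsineIntegral (fun x y => x ^ n * y ^ m) = arcsineMoment n * arcsineMoment m := by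
  simp [arcsineIntegral, arcsineMoment]

/-- The polynomial form of `Γ(xⁿ, xᵐ)`, without its normalising constant. -/
def powGam (n m : ℕ) : ℝ :=
  arcsineIntegral fun x y => powDiffQuot n x y * powDiffQuot m x y * (1 - x * y)

theorem Gam_pow (n m : ℕ) :
    Gam (fun x => x ^ n) (fun x => x ^ m) = 1 / Real.pi ^ 2 * powGam n m := by
  have inner (x : ℝ) :
      ∫ y in (-1 : ℝ)..1, ((x ^ n - y ^ n) / (x - y)) * ((x ^ m - y ^ m) / (x - y)) *
        ((1 - x * y) / (Real.sqrt (1 - x ^ 2) * Real.sqrt (1 - y ^ 2))) =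
      (∫ y, powDiffQuot n x y * powDiffQuot m x y * (1 - x * y) ∂Polynomial.Chebyshev.measureT) *
        √(1 - x ^ 2)⁻¹ := by
    rw [Polynomial.Chebyshev.integral_measureT, ← intervalIntegral.integral_mul_const]
    refine intervalIntegral.integral_congr_ae ?_
    filter_upwards [Measure.ae_ne volume x] with y hy _
    have hxy : x - y ≠ 0 := sub_ne_zero.mpr hy.symm
    rw [← powDiffQuot_mul, ← powDiffQuot_mul, mul_div_cancel_right₀ _ hxy,
      mul_div_cancel_right₀ _ hxy, Real.sqrt_inv, Real.sqrt_inv, div_eq_mul_inv, mul_inv]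
    ring
  rw [Gam]
  congr 1
  simp only [inner]
  rw [← Polynomial.Chebyshev.integral_measureT,
    Polynomial.Chebyshev.integral_measureT_eq_integral_cos]
  simp only [Polynomial.Chebyshev.integral_measureT_eq_integral_cos]
  rfl

theorem powGam_zero_left (m : ℕ) : powGam 0 m = 0 := by
  simp [powGam, powDiffQuot, arcsineIntegral]

theorem powGam_zero_right (n : ℕ) : powGam n 0 = 0 := by
  simp [powGam, powDiffQuot, arcsineIntegral]

theorem powGam_second_difference (n m : ℕ) :
    powGam (n + 2) m + powGam n (m + 2) = 2 * powGam (n + 1) (m + 1)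
      - 2 * (arcsineMoment n * arcsineMoment m)
      + 2 * (arcsineMoment (n + 1) * arcsineMoment (m + 1)) := by
  have key : arcsineIntegral (fun x y =>
        (powDiffQuot (n + 2) x y * powDiffQuot m x y * (1 - x * y) +
          powDiffQuot n x y * powDiffQuot (m + 2) x y * (1 - x * y)) +
        (x ^ n * y ^ m + x ^ m * y ^ n)) =
      arcsineIntegral (fun x y =>
        2 * (powDiffQuot (n + 1) x y * powDiffQuot (m + 1) x y * (1 - x * y)) +
        (x ^ (n + 1) * y ^ (m + 1) + x ^ (m + 1) * y ^ (n + 1))) := by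
    congr! 3 with x y
    linear_combination (1 - x * y) * powDiffQuot_second_difference n m x y
  rw [arcsineIntegral_add, arcsineIntegral_add, arcsineIntegral_add, arcsineIntegral_add,
    arcsineIntegral_add, arcsineIntegral_const_mul] at key
  · simp only [arcsineIntegral_pow_mul_pow] at key
    unfold powGam
    linear_combination key
  all_goals
    unfold Function.uncurry
    fun_prop

theorem eq_zero_of_second_difference {d : ℕ → ℕ → ℝ} (left : ∀ m, d 0 m = 0)
    (right : ∀ n, d n 0 = 0)
    (rec : ∀ n m, d (n + 2) m + d n (m + 2) = 2 * d (n + 1) (m + 1)) (n m : ℕ) : d n m = 0 := by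
  have linear (k : ℕ) : ∀ m, d (k + 1) m = (k + 1) * d 1 (m + k) ∧
      d k (m + 1) = k * d 1 (m + k) := by
    induction k with
    | zero => simp [left]
    | succ k ih =>
      intro m
      have h₁ := (ih (m + 1)).1
      have h₂ := (ih (m + 1)).2
      rw [add_right_comm m 1 k, add_assoc m k 1] at h₁ h₂
      push_cast
      exact ⟨by linear_combination rec k m + 2 * h₁ - h₂, h₁⟩
  have base (k : ℕ) : d 1 k = 0 := by
    have h := (linear k 0).1
    rw [right, zero_add, eq_comm, mul_eq_zero] at h
    exact h.resolve_left (by positivity)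
  cases n with
  | zero => exact left m
  | succ n => rw [(linear n m).1, base, mul_zero]

theorem add_mul_powGam (n m : ℕ) :
    (n + m) * powGam n m = 2 * (n * arcsineMoment n * (m * arcsineMoment m) +
      (n + 1) * arcsineMoment (n + 1) * ((m + 1) * arcsineMoment (m + 1))) := by
  rw [← sub_eq_zero]
  refine eq_zero_of_second_difference (d := fun n m : ℕ => (n + m) * powGam n m -
    2 * (n * arcsineMoment n * (m * arcsineMoment m) +
      (n + 1) * arcsineMoment (n + 1) * ((m + 1) * arcsineMoment (m + 1)))) ?_ ?_ ?_ n m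
  · simp [powGam_zero_left, arcsineMoment_one]
  · simp [powGam_zero_right, arcsineMoment_one]
  · intro n m
    have hn := arcsineMoment_add_two n
    have hm := arcsineMoment_add_two m
    have hn' := arcsineMoment_add_two (n + 1)
    have hm' := arcsineMoment_add_two (m + 1)
    simp only [add_assoc, Nat.reduceAdd] at hn' hm' ⊢
    push_cast at hn' hm' ⊢
    linear_combination ((n : ℝ) + m + 2) * powGam_second_difference n m
      + (4 * (m + 2) * arcsineMoment (m + 2) - 2 * m * arcsineMoment m) * hn
      + (2 * n + 4) * arcsineMoment n * hm
      - 2 * (m + 1) * arcsineMoment (m + 1) * hn' - 2 * (n + 1) * arcsineMoment (n + 1) * hm'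

theorem powGam_even (n m : ℕ) :
    powGam (2 * n) (2 * m) =
      4 * (n * m / (n + m)) * (arcsineMoment (2 * n) * arcsineMoment (2 * m)) := by
  rcases Nat.eq_zero_or_pos n with rfl | hn
  · simp [powGam_zero_left]
  have h := add_mul_powGam (2 * n) (2 * m)
  rw [arcsineMoment_odd] at h
  push_cast at h
  field_simp
  linear_combination h / 2

theorem arcsineMoment_two_mul_succ (n : ℕ) :
    arcsineMoment (2 * (n + 1)) = (2 * n + 1) / (2 * n + 2) * arcsineMoment (2 * n) := by
  have h := arcsineMoment_add_two (2 * n)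
  push_cast at h
  rw [mul_add_one]
  field_simp
  linear_combination h

theorem arcsineMoment_even_nonneg (n : ℕ) : 0 ≤ arcsineMoment (2 * n) :=
  intervalIntegral.integral_nonneg Real.pi_pos.le fun _ _ => (even_two_mul n).pow_nonneg _

theorem exists_tendsto_sqrt_mul_arcsineMoment :
    ∃ l : ℝ, Tendsto (fun n : ℕ => √n * arcsineMoment (2 * n)) atTop (𝓝 l) := by
  have mono : Monotone fun n : ℕ => n * arcsineMoment (2 * n) ^ 2 := by
    refine monotone_nat_of_le_succ fun n => ?_
    rw [arcsineMoment_two_mul_succ, mul_pow, ← mul_assoc]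
    refine mul_le_mul_of_nonneg_right ?_ (sq_nonneg _)
    push_cast
    rw [div_pow, mul_div_assoc', le_div_iff₀ (by positivity)]
    nlinarith [(Nat.cast_nonneg n : (0 : ℝ) ≤ n)]
  have anti : Antitone fun n : ℕ => (2 * n + 1) * arcsineMoment (2 * n) ^ 2 := by
    refine antitone_nat_of_succ_le fun n => ?_
    rw [arcsineMoment_two_mul_succ, mul_pow, ← mul_assoc]
    refine mul_le_mul_of_nonneg_right ?_ (sq_nonneg _)
    push_cast
    rw [div_pow, mul_div_assoc', div_le_iff₀ (by positivity)]
    nlinarith [(Nat.cast_nonneg n : (0 : ℝ) ≤ n)]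
  have bdd : BddAbove (Set.range fun n : ℕ => n * arcsineMoment (2 * n) ^ 2) := by
    refine ⟨Real.pi ^ 2, ?_⟩
    rintro _ ⟨n, rfl⟩
    have h := anti (Nat.zero_le n)
    simp only [mul_zero, arcsineMoment_zero, Nat.cast_zero, zero_add, one_mul] at h
    refine le_trans (mul_le_mul_of_nonneg_right ?_ (sq_nonneg _)) h
    linarith [(Nat.cast_nonneg n : (0 : ℝ) ≤ n)]
  refine ⟨_, (tendsto_atTop_ciSup mono bdd).sqrt.congr fun n => ?_⟩
  rw [Real.sqrt_mul n.cast_nonneg, Real.sqrt_sq (arcsineMoment_even_nonneg n)]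

theorem Gam_pow_even_mul (A i : ℕ) :
    Gam (fun x => x ^ (2 * i)) (fun x => x ^ (2 * A * i)) =
      4 / Real.pi ^ 2 * (√A / (1 + A)) * ((√i * arcsineMoment (2 * i)) *
        (√(A * i : ℕ) * arcsineMoment (2 * (A * i)))) := by
  rw [Gam_pow, mul_assoc 2 A i, powGam_even]
  push_cast
  rw [Real.sqrt_mul A.cast_nonneg]
  rcases Nat.eq_zero_or_pos i with rfl | hi
  · simp
  have hA := Real.mul_self_sqrt (Nat.cast_nonneg A : (0 : ℝ) ≤ A)
  have hi' := Real.mul_self_sqrt (Nat.cast_nonneg i : (0 : ℝ) ≤ i)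
  have hfrac : (i * (A * i) / (i + A * i) : ℝ) = A / (1 + A) * i := by
    field_simp
  rw [hfrac]
  generalize arcsineMoment (2 * i) = a, arcsineMoment (2 * (A * i)) = b
  calc _ = 4 / Real.pi ^ 2 * ((√A * √A) / (1 + A)) * (√i * √i) * (a * b) := by
        rw [hA, hi']; ring
    _ = _ := by ring

theorem tendsto_sqrt_div_one_add :
    Tendsto (fun A : ℕ => √(A : ℝ) / (1 + A)) atTop (𝓝 0) := by
  refine squeeze_zero (fun A => by positivity) (fun A => ?_)
    (tendsto_inv_atTop_zero.comp (Real.tendsto_sqrt_atTop.comp tendsto_natCast_atTop_atTop))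
  rcases Nat.eq_zero_or_pos A with rfl | hA
  · simp
  have hs : 0 < √(A : ℝ) := Real.sqrt_pos.mpr (by exact_mod_cast hA)
  simp only [Function.comp_apply]
  rw [div_le_iff₀ (by positivity), inv_mul_eq_div, le_div_iff₀ hs,
    Real.mul_self_sqrt A.cast_nonneg]
  linarith

/-- Lemma 2.10(2) of the paper: for each positive integer `A`, the limit
`L(A) = lim_{i → ∞} Γ(p_{2i}, p_{2Ai})` (over positive integers `i`) exists, and `L(A) → 0`
as `A → ∞`. -/
theorem Gam_offdiagonal_limit :
    ∃ L : ℕ → ℝ,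
      (∀ A : ℕ, 0 < A →
        Tendsto (fun i : ℕ => Gam (fun x => x ^ (2 * i)) (fun x => x ^ (2 * A * i)))
          atTop (𝓝 (L A))) ∧
      Tendsto L atTop (𝓝 0) := by
  obtain ⟨l, hl⟩ := exists_tendsto_sqrt_mul_arcsineMoment
  refine ⟨fun A => 4 / Real.pi ^ 2 * (√A / (1 + A)) * (l * l), fun A hA => ?_, ?_⟩
  · simp only [Gam_pow_even_mul]
    exact (hl.mul (hl.comp (tendsto_id.const_mul_atTop' hA))).const_mul _
  · simpa using (tendsto_sqrt_div_one_add.const_mul (4 / Real.pi ^ 2)).mul_const (l * l)
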